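/- In the Normal Domination Game, the Grundy values of the positions P''_1, P''_2, P''_3 and P''_4 are 1, 2, 3 and 0, respectively, and the Grundy values of the positions P'_1, P'_2, P'_3 and P'_4 are 1, 2, 3 and 0, respectively. -/

import Mathlib

open SimpleGraph Finset

/-- A vertex `u` is dominated by the selected set `S` if it lies in the closed
neighborhood of some selected vertex. -/
def Dominated {V : Type} (G : SimpleGraph V) (S : Finset V) (u : V) : Prop :=
  ∃ s ∈ S, u = s ∨ G.Adj s u

/-- A vertex `v` is playable in position `S` if some vertex of the closed
neighborhood of `v` is not dominated by `S`. -/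
def Playable {V : Type} (G : SimpleGraph V) (S : Finset V) (v : V) : Prop :=
  ∃ u, (u = v ∨ G.Adj v u) ∧ ¬ Dominated G S u

lemma Playable.not_mem {V : Type} {G : SimpleGraph V} {S : Finset V} {v : V}
    (h : Playable G S v) : v ∉ S := by
  intro hv
  obtain ⟨u, hu, hnd⟩ := h
  exact hnd ⟨v, hv, hu.imp id (fun a => a)⟩

lemma Playable.card_lt {V : Type} [Fintype V] [DecidableEq V]
    {G : SimpleGraph V} {S : Finset V} {v : V} (h : Playable G S v) :
    (Finset.univ \ insert v S).card < (Finset.univ \ S).card := by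
  apply Finset.card_lt_card
  refine ⟨Finset.sdiff_subset_sdiff (le_refl _) (Finset.subset_insert v S), ?_⟩
  intro hsub
  have hv : v ∈ Finset.univ \ S := by simp [h.not_mem]
  have := hsub hv
  simp at this

/-- The Grundy value (nimber) of a position of the Normal Domination Game:
the minimum excludant (least natural number not attained) of the Grundy values
of the positions reachable in one move (i.e. by selecting a playable vertex). -/
noncomputable def grundy {V : Type} [Fintype V] [DecidableEq V]
    (G : SimpleGraph V) (S : Finset V) : ℕ :=
  sInf {m : ℕ |
    m ∉ Set.range fun v : {v : V // Playable G S v} => grundy G (insert v.1 S)}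
termination_by (Finset.univ \ S).card
decreasing_by exact v.2.card_lt

/-- The position `P'ₙ`: the path on `n + 2` vertices in which the first vertex
is the only selected vertex. Its Grundy value. -/
noncomputable def grundyP' (n : ℕ) : ℕ :=
  grundy (SimpleGraph.pathGraph (n + 2)) {(0 : Fin (n + 2))}

/-- The position `P''ₙ`: the path on `n + 4` vertices in which the first and the
last vertices are the only selected vertices. Its Grundy value. -/
noncomputable def grundyP'' (n : ℕ) : ℕ :=
  grundy (SimpleGraph.pathGraph (n + 4)) {(0 : Fin (n + 4)), Fin.last (n + 3)}

/-- The minimum excludant of a list of natural numbers. -/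
def listMex (l : List ℕ) : ℕ :=
  ((List.range (l.length + 1)).find? fun m => !l.contains m).getD 0

lemma listMex_eq_sInf (l : List ℕ) : listMex l = sInf {m : ℕ | m ∉ l} := by
  unfold listMex
  cases h : (List.range (l.length + 1)).find? fun m => !l.contains m with
  | none =>
    have hsub : List.range (l.length + 1) ⊆ l := by
      intro m hm
      simpa using List.find?_eq_none.1 h m hm
    have hlen := (List.nodup_range.subperm hsub).length_le
    simp at hlen
  | some m =>
    rw [List.find?_range_eq_some] at h
    obtain ⟨hm, -, hlt⟩ := h
    have hmem : m ∈ {m : ℕ | m ∉ l} := by simpa using hm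
    refine (le_antisymm (Nat.sInf_le hmem) (le_csInf ⟨m, hmem⟩ fun b hb => ?_)).symm
    by_contra! hbm
    exact hb (by simpa using hlt b hbm)

/-- A computable form of the Grundy value: `vs` lists the vertices, `near` is the Boolean
closed-neighborhood relation, `U` lists the undominated vertices, and the first numeral bounds
the depth of the recursion. -/
def listGrundy {V : Type} (vs : List V) (near : V → V → Bool) : ℕ → List V → ℕ
  | 0, _ => 0
  | k + 1, U =>
    listMex ((((vs.map fun v => U.filter fun u => !near v u)).filter
      fun W => W.length < U.length).map (listGrundy vs near k))

lemma dominated_insert {V : Type} [DecidableEq V] {G : SimpleGraph V} {S : Finset V} {u v : V} :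
    Dominated G (insert v S) u ↔ (u = v ∨ G.Adj v u) ∨ Dominated G S u := by
  simp [Dominated]

lemma playable_iff_length_filter_lt {V : Type} {G : SimpleGraph V} {near : V → V → Bool}
    (hnear : ∀ v u, near v u = true ↔ u = v ∨ G.Adj v u) {S : Finset V} {U : List V}
    (hU : ∀ u, u ∈ U ↔ ¬ Dominated G S u) (v : V) :
    Playable G S v ↔ (U.filter fun u => !near v u).length < U.length := by
  rw [List.length_filter_lt_length_iff_exists]
  constructor
  · rintro ⟨u, hu, hd⟩
    exact ⟨u, (hU u).2 hd, by simpa using (hnear v u).2 hu⟩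
  · rintro ⟨u, hu, hn⟩
    exact ⟨u, (hnear v u).1 (by simpa using hn), (hU u).1 hu⟩

lemma grundy_eq_listGrundy {V : Type} [Fintype V] [DecidableEq V] {G : SimpleGraph V}
    {vs : List V} (hvs : ∀ v, v ∈ vs) {near : V → V → Bool}
    (hnear : ∀ v u, near v u = true ↔ u = v ∨ G.Adj v u) (k : ℕ) (S : Finset V) (U : List V)
    (hU : ∀ u, u ∈ U ↔ ¬ Dominated G S u) (hk : U.length < k) :
    grundy G S = listGrundy vs near k U := by
  induction k generalizing S U with
  | zero => omega
  | succ k ih =>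
    have hmove (v : V) (hv : (U.filter fun u => !near v u).length < U.length) :
        grundy G (insert v S) = listGrundy vs near k (U.filter fun u => !near v u) := by
      refine ih _ _ (fun u => ?_) (by omega)
      rw [List.mem_filter, hU, dominated_insert, ← hnear]
      cases near v u <;> simp
    rw [grundy, listGrundy, listMex_eq_sInf]
    congr 1
    ext m
    simp only [Set.mem_ofPred_eq, not_iff_not, Set.mem_range, Subtype.exists, List.mem_map,
      List.mem_filter, decide_eq_true_eq]
    constructor
    · rintro ⟨v, hv, rfl⟩
      have hlt := (playable_iff_length_filter_lt hnear hU v).1 hv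
      exact ⟨_, ⟨⟨v, hvs v, rfl⟩, hlt⟩, (hmove v hlt).symm⟩
    · rintro ⟨_, ⟨⟨v, -, rfl⟩, hlt⟩, rfl⟩
      exact ⟨v, (playable_iff_length_filter_lt hnear hU v).2 hlt, hmove v hlt⟩

/-- The Boolean closed-neighborhood relation of the path graph on `n` vertices. -/
def pathNear {n : ℕ} (v u : Fin n) : Bool :=
  decide (u.val ≤ v.val + 1) && decide (v.val ≤ u.val + 1)

lemma pathNear_iff {n : ℕ} (v u : Fin n) :
    pathNear v u = true ↔ u = v ∨ (SimpleGraph.pathGraph n).Adj v u := by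
  simp only [pathNear, Bool.and_eq_true, decide_eq_true_eq, SimpleGraph.pathGraph_adj, Fin.ext_iff]
  omega

lemma grundy_pathGraph {n : ℕ} (l : List (Fin n)) :
    grundy (SimpleGraph.pathGraph n) l.toFinset =
      listGrundy (List.finRange n) pathNear (n + 1)
        ((List.finRange n).filter fun u => !l.any fun s => pathNear s u) := by
  refine grundy_eq_listGrundy List.mem_finRange pathNear_iff _ _ _ (fun u => ?_) ?_
  · simp [Dominated, ← pathNear_iff]
  · exact Nat.lt_succ_of_le ((List.length_filter_le _ _).trans_eq List.length_finRange)

lemma grundyP'_eq (n : ℕ) :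
    grundyP' n = listGrundy (List.finRange (n + 2)) pathNear (n + 3)
      ((List.finRange (n + 2)).filter fun u => !pathNear 0 u) := by
  simpa [grundyP'] using grundy_pathGraph [(0 : Fin (n + 2))]

lemma grundyP''_eq (n : ℕ) :
    grundyP'' n = listGrundy (List.finRange (n + 4)) pathNear (n + 5)
      ((List.finRange (n + 4)).filter fun u =>
        !(pathNear 0 u || pathNear (Fin.last (n + 3)) u)) := by
  simpa [grundyP''] using grundy_pathGraph [(0 : Fin (n + 4)), Fin.last (n + 3)]

theorem grundyP'_P''_small :
    grundyP'' 1 = 1 ∧ grundyP'' 2 = 2 ∧ grundyP'' 3 = 3 ∧ grundyP'' 4 = 0 ∧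
    grundyP' 1 = 1 ∧ grundyP' 2 = 2 ∧ grundyP' 3 = 3 ∧ grundyP' 4 = 0 := by
  simp only [grundyP'_eq, grundyP''_eq]
  decide +kernel
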